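/- arXiv:1509.05552 — 2 statements merged into one kernel-verified Lean document; each statement's English description precedes it below -/
import Mathlib

section
/- Let H be a complex Hilbert space (inner product conjugate-linear in the first argument) and let u : ℝ^d → H be twice continuously differentiable with ‖u(ζ)‖ = 1 for all ζ ∈ ℝ^d. Fix p ∈ ℝ^d and let A(p)h := i·⟨u(p), Du(p)h⟩ (a real number for each h ∈ ℝ^d). Then, as h → 0, ⟨u(p+h), u(p)⟩ = exp(i·A(p)h) + O(‖h‖²); i.e. the function h ↦ ⟨u(p+h), u(p)⟩ − exp(i·A(p)h) is O(‖h‖²) as h → 0. -/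
open scoped InnerProductSpace

/-- First-order Taylor expansion of a map which is `C²` at `p`, with quadratic remainder. -/
theorem ContDiffAt.sub_sub_fderiv_isBigO_norm_sq
    {E F : Type*} [NormedAddCommGroup E] [NormedSpace ℝ E]
    [NormedAddCommGroup F] [NormedSpace ℝ F] {f : E → F} {p : E}
    (hf : ContDiffAt ℝ 2 f p) :
    (fun h : E => f (p + h) - f p - fderiv ℝ f p h) =O[nhds 0] fun h => ‖h‖ ^ 2 := by
  obtain ⟨K, t, ht, hK⟩ :=
    (hf.fderiv_right (m := 1) (by norm_num)).exists_lipschitzOnWith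
  have hd : ∀ᶠ x in nhds p, DifferentiableAt ℝ f x :=
    (hf.eventually (by simp)).mono fun x hx => hx.differentiableAt (by norm_num)
  obtain ⟨r, hr, hball⟩ := Metric.mem_nhds_iff.1 (Filter.inter_mem ht hd)
  refine Asymptotics.IsBigO.of_bound K ?_
  filter_upwards [Metric.ball_mem_nhds (0 : E) hr] with h hh
  have hsub : Metric.closedBall p ‖h‖ ⊆ Metric.ball p r :=
    Metric.closedBall_subset_ball (mem_ball_zero_iff.1 hh)
  have hbound : ∀ x ∈ Metric.closedBall p ‖h‖, ‖fderiv ℝ f x - fderiv ℝ f p‖ ≤ K * ‖h‖ := by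
    intro x hx
    rw [← dist_eq_norm]
    refine (hK.dist_le_mul x (hball (hsub hx)).1 p (mem_of_mem_nhds ht)).trans ?_
    gcongr
    exact hx
  have hmv := (convex_closedBall p ‖h‖).norm_image_sub_le_of_norm_fderiv_le'
    (fun x hx => (hball (hsub hx)).2) hbound
    (Metric.mem_closedBall_self (norm_nonneg h)) (y := p + h) (by simp)
  simpa [pow_two, mul_assoc] using hmv

/-- A family of unit vectors has skew inner product with its derivative. -/
theorem inner_fderiv_left_eq_neg_of_norm_eq_one
    {E H : Type*} [NormedAddCommGroup E] [NormedSpace ℝ E]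
    [NormedAddCommGroup H] [InnerProductSpace ℂ H] {u : E → H} {p : E}
    (hu : DifferentiableAt ℝ u p) (hnorm : ∀ ζ, ‖u ζ‖ = 1) (h : E) :
    ⟪fderiv ℝ u p h, u p⟫_ℂ = -⟪u p, fderiv ℝ u p h⟫_ℂ := by
  have hconst : (fun ζ => ⟪u ζ, u ζ⟫_ℂ) = fun _ => (1 : ℂ) := by
    funext ζ
    simp [inner_self_eq_norm_sq_to_K, hnorm]
  have key := fderiv_inner_apply ℂ hu hu h
  rw [hconst] at key
  simp only [fderiv_fun_const, Pi.zero_apply, zero_apply] at key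
  linear_combination -key

/-- For a normalized `C²` family `u : ℝ^d → H` in a complex Hilbert space, the
overlap `⟨u(p+h), u(p)⟩` equals `exp(i·A(p)h)` up to `O(‖h‖²)` as `h → 0`,
where `A(p)h = i·⟨u(p), Du(p)h⟩` is the Berry connection. -/
theorem overlap_eq_exp_berry_phase_increment
    {d : ℕ} {H : Type*} [NormedAddCommGroup H] [InnerProductSpace ℂ H]
    [CompleteSpace H]
    (u : EuclideanSpace ℝ (Fin d) → H)
    (hu : ContDiff ℝ 2 u)
    (hnorm : ∀ ζ, ‖u ζ‖ = 1)
    (p : EuclideanSpace ℝ (Fin d)) :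
    (fun h : EuclideanSpace ℝ (Fin d) =>
        ⟪u (p + h), u p⟫_ℂ -
          Complex.exp (Complex.I * (Complex.I * ⟪u p, fderiv ℝ u p h⟫_ℂ)))
      =O[nhds 0] fun h => ‖h‖ ^ 2 := by
  have htaylor : (fun h => ⟪u (p + h) - u p - fderiv ℝ u p h, u p⟫_ℂ)
      =O[nhds 0] fun h => ‖h‖ ^ 2 := by
    refine (Asymptotics.IsBigO.of_bound' (.of_forall fun h => ?_)).trans
      (hu.contDiffAt (x := p)).sub_sub_fderiv_isBigO_norm_sq
    simpa only [hnorm, mul_one] using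
      norm_inner_le_norm (𝕜 := ℂ) (u (p + h) - u p - fderiv ℝ u p h) (u p)
  have hlin : (fun h => -⟪u p, fderiv ℝ u p h⟫_ℂ) =O[nhds 0] fun h => h := by
    refine (Asymptotics.IsBigO.of_bound' (.of_forall fun h => ?_)).trans
      ((fderiv ℝ u p).isBigO_id (nhds 0))
    simpa [hnorm] using norm_inner_le_norm (𝕜 := ℂ) (u p) (fderiv ℝ u p h)
  have hexp := ((Complex.exp_sub_sum_range_isBigO_pow 2).comp_tendsto
    (hlin.trans_tendsto Filter.tendsto_id)).trans (hlin.norm_right.pow 2)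
  refine (htaylor.sub hexp).congr_left fun h => ?_
  have hI : Complex.I * (Complex.I * ⟪u p, fderiv ℝ u p h⟫_ℂ) = -⟪u p, fderiv ℝ u p h⟫_ℂ := by
    rw [← mul_assoc, Complex.I_mul_I, neg_one_mul]
  have hself : ⟪u p, u p⟫_ℂ = 1 := by simp [inner_self_eq_norm_sq_to_K, hnorm]
  simp only [Function.comp_apply, Finset.sum_range_succ, Finset.sum_range_zero, hI,
    inner_sub_left, hself,
    inner_fderiv_left_eq_neg_of_norm_eq_one (hu.differentiable (by norm_num) p) hnorm h]
  norm_num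
  ring
end

section
/- Fix d ≥ 1 and ε > 0, and for q, p ∈ ℝ^d let G^ε_{q,p}(x) := exp(−‖x−q‖²/(2ε) + i p·(x−q)/ε). Then for every Schwartz function f on ℝ^d and every x ∈ ℝ^d, 2^{d/2} (2πε)^{−3d/2} ∫_{ℝ^d} ∫_{ℝ^d} G^ε_{q,p}(x) · ( ∫_{ℝ^d} conj(G^ε_{q,p}(y)) f(y) dy ) dq dp = f(x). That is, the semiclassical Gaussian wave packets form a resolution of the identity (the FBI/Gabor inversion formula with Gaussian window), which is the reconstruction identity underlying the frozen Gaussian approximation at time t = 0. -/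
open scoped InnerProductSpace

open MeasureTheory FourierTransform Convolution

section FourierMul

variable {V : Type*} [NormedAddCommGroup V] [InnerProductSpace ℝ V] [FiniteDimensional ℝ V]
  [MeasurableSpace V] [BorelSpace V]

/-- Multiplying a Schwartz function by the Fourier transform of a bounded continuous integrable
function gives a function with integrable Fourier transform, provided the product is integrable. -/
theorem integrable_fourier_fourier_mul_schwartz {u : V → ℂ} (hu : Integrable u)
    (hc : Continuous u) (hb : BddAbove (Set.range fun v ↦ ‖u v‖)) (f : SchwartzMap V ℂ)
    (hi : Integrable (fun v ↦ 𝓕 u v * f v)) :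
    Integrable (𝓕 (fun v ↦ 𝓕 u v * f v)) := by
  have hg : Integrable (𝓕⁻ f : SchwartzMap V ℂ) := (𝓕⁻ f : SchwartzMap V ℂ).integrable
  set c : V → ℂ := u ⋆[ContinuousLinearMap.mul ℂ ℂ] (𝓕⁻ f : SchwartzMap V ℂ)
  have hFg : 𝓕 ((𝓕⁻ f : SchwartzMap V ℂ) : V → ℂ) = f := by
    rw [← SchwartzMap.fourier_coe, FourierTransform.fourier_fourierInv_eq]
  have hFc : 𝓕 c = fun v ↦ 𝓕 u v * f v := by
    ext v
    rw [Real.fourier_mul_convolution_eq hu hg, hFg]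
  have hci : Integrable c := hu.integrable_convolution _ hg
  have hcc : Continuous c := hb.continuous_convolution_left_of_integrable _ hc hg
  have hinv : 𝓕⁻ (fun v ↦ 𝓕 u v * f v) = c := by
    rw [← hFc]
    exact hcc.fourierInv_fourier_eq hci (hFc ▸ hi)
  have hneg : 𝓕 (fun v ↦ 𝓕 u v * f v) = fun v ↦ c (-v) := by
    ext v
    rw [← hinv, Real.fourierInv_eq_fourier_neg, neg_neg]
  rw [hneg]
  exact hci.comp_neg

theorem integrable_gaussian_mul_schwartz {a : ℝ} (ha : 0 < a) (x : V) (f : SchwartzMap V ℂ) :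
    Integrable (fun y ↦ ((Real.exp (-a * ‖x - y‖ ^ 2) : ℝ) : ℂ) * f y) := by
  refine f.integrable.bdd_mul (c := 1) (by fun_prop) (.of_forall fun y ↦ ?_)
  rw [Complex.norm_real, Real.norm_of_nonneg (Real.exp_pos _).le, Real.exp_le_one_iff]
  nlinarith [sq_nonneg ‖x - y‖]

theorem integrable_fourier_gaussian_mul_schwartz {a : ℝ} (ha : 0 < a) (x : V)
    (f : SchwartzMap V ℂ) :
    Integrable (𝓕 (fun y ↦ ((Real.exp (-a * ‖x - y‖ ^ 2) : ℝ) : ℂ) * f y)) := by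
  have hπ := Real.pi_pos
  set b : ℝ := Real.pi ^ 2 / a with hbdef
  have hb0 : 0 < b := by positivity
  have hb : 0 < (b : ℂ).re := by simpa
  set C : ℂ := (Real.pi / (b : ℂ)) ^ (Module.finrank ℝ V / 2 : ℂ)
  set u : V → ℂ := fun v ↦ C⁻¹ * Complex.exp (-b * ‖v‖ ^ 2 + 2 * Real.pi * Complex.I * ⟪x, v⟫_ℝ)
  have hC : C ≠ 0 := by
    have : (Real.pi : ℂ) / b ≠ 0 := by
      rw [← Complex.ofReal_div, Complex.ofReal_ne_zero]; positivity
    simp [C, Complex.cpow_eq_zero_iff, this]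
  have hFu : 𝓕 u = fun y ↦ ((Real.exp (-a * ‖x - y‖ ^ 2) : ℝ) : ℂ) := by
    ext y
    have h := fourier_gaussian_innerProductSpace' hb x y
    rw [Real.fourier_eq] at h ⊢
    simp only [u, Circle.smul_def, smul_eq_mul] at h ⊢
    simp_rw [mul_left_comm _ C⁻¹]
    rw [integral_const_mul, h, inv_mul_cancel_left₀ hC, Complex.ofReal_exp, hbdef]
    congr 1
    have : (Real.pi : ℂ) ≠ 0 := by exact_mod_cast hπ.ne'
    have : (a : ℂ) ≠ 0 := by exact_mod_cast ha.ne'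
    push_cast
    field_simp
  have hu : Integrable u :=
    (GaussianFourier.integrable_cexp_neg_mul_sq_norm_add hb (2 * Real.pi * Complex.I) x).const_mul _
  have hbdd : BddAbove (Set.range fun v ↦ ‖u v‖) := by
    refine ⟨‖C⁻¹‖, ?_⟩
    rintro _ ⟨v, rfl⟩
    simp only [u, norm_mul]
    refine mul_le_of_le_one_right (norm_nonneg _) ?_
    rw [Complex.norm_exp, Real.exp_le_one_iff]
    have : (-b * ‖v‖ ^ 2 + 2 * Real.pi * Complex.I * ⟪x, v⟫_ℝ : ℂ).re = -b * ‖v‖ ^ 2 := by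
      simp [← Complex.ofReal_pow]
    rw [this]
    nlinarith [sq_nonneg ‖v‖]
  have := integrable_fourier_fourier_mul_schwartz hu (by fun_prop) hbdd f
  simp only [hFu] at this
  exact this (integrable_gaussian_mul_schwartz ha x f)

/-- The semiclassical Fourier inversion formula, with the phases combined. -/
theorem integral_integral_cexp_inner_sub_mul {ε : ℝ} (hε : 0 < ε) {h : V → ℂ} (hc : Continuous h)
    (hi : Integrable h) (hF : Integrable (𝓕 h)) (x : V) :
    ∫ p : V, ∫ y : V, Complex.exp (Complex.I * ((⟪p, x - y⟫_ℝ / ε : ℝ) : ℂ)) * h y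
      = ((2 * Real.pi * ε) ^ Module.finrank ℝ V : ℝ) * h x := by
  have hπ := Real.pi_pos
  let Φ : V → ℂ := fun w ↦ Complex.exp (↑(2 * Real.pi * ⟪w, x⟫_ℝ) * Complex.I) • 𝓕 h w
  have hphase (p : V) : ∫ y : V, Complex.exp (Complex.I * ((⟪p, x - y⟫_ℝ / ε : ℝ) : ℂ)) * h y
      = Φ ((2 * Real.pi * ε)⁻¹ • p) := by
    simp only [Φ, Real.fourier_eq', smul_eq_mul]
    rw [← integral_const_mul]
    refine integral_congr_ae (.of_forall fun y ↦ ?_)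
    simp only [← mul_assoc, ← Complex.exp_add]
    congr 2
    rw [inner_sub_right, inner_smul_left, inner_smul_right, real_inner_comm p y]
    have : (Real.pi : ℂ) ≠ 0 := by exact_mod_cast hπ.ne'
    have : (ε : ℂ) ≠ 0 := by exact_mod_cast hε.ne'
    simp only [conj_trivial]
    push_cast
    field_simp
    ring
  simp_rw [hphase]
  rw [Measure.integral_comp_inv_smul_of_nonneg volume Φ (by positivity), ← Real.fourierInv_eq',
    hc.fourierInv_fourier_eq hi hF, Complex.real_smul]

theorem integral_exp_neg_sq_norm_sub_mul {ε : ℝ} (hε : 0 < ε) (x y : V) :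
    ∫ q : V, Real.exp (-‖x - q‖ ^ 2 / (2 * ε)) * Real.exp (-‖y - q‖ ^ 2 / (2 * ε))
      = (Real.pi * ε) ^ (Module.finrank ℝ V / 2 : ℝ)
        * Real.exp (-(1 / (4 * ε)) * ‖x - y‖ ^ 2) := by
  have key (q : V) : Real.exp (-‖x - q‖ ^ 2 / (2 * ε)) * Real.exp (-‖y - q‖ ^ 2 / (2 * ε))
      = Real.exp (-(1 / ε) * ‖q - (1 / 2 : ℝ) • (x + y)‖ ^ 2)
        * Real.exp (-(1 / (4 * ε)) * ‖x - y‖ ^ 2) := by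
    rw [← Real.exp_add, ← Real.exp_add]
    congr 1
    have h := parallelogram_law_with_norm ℝ (x - q) (y - q)
    have h1 : x - q + (y - q) = (-2 : ℝ) • (q - (1 / 2 : ℝ) • (x + y)) := by module
    rw [h1, norm_smul, sub_sub_sub_cancel_right] at h
    rw [Real.norm_eq_abs, abs_neg, abs_two] at h
    field_simp
    linarith
  simp_rw [key]
  rw [integral_mul_const,
    integral_sub_right_eq_self (fun q : V ↦ Real.exp (-(1 / ε) * ‖q‖ ^ 2)),
    GaussianFourier.integral_rexp_neg_mul_sq_norm (by positivity)]
  simp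

theorem integrable_exp_neg_sq_norm_sub {ε : ℝ} (hε : 0 < ε) (x : V) :
    Integrable (fun q ↦ Real.exp (-‖x - q‖ ^ 2 / (2 * ε))) := by
  have h : Integrable (fun v : V ↦ Real.exp (-(1 / (2 * ε)) * ‖v‖ ^ 2)) := by
    have h := (GaussianFourier.integrable_cexp_neg_mul_sq_norm_add (V := V)
      (b := ((1 / (2 * ε) : ℝ) : ℂ)) (by rw [Complex.ofReal_re]; positivity) 0 0).norm
    refine h.congr (.of_forall fun v ↦ ?_)
    simp [Complex.norm_exp, ← Complex.ofReal_pow]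
  refine (h.comp_sub_left x).congr (.of_forall fun q ↦ ?_)
  ring_nf

end FourierMul

/-- Resolution of the identity by semiclassical Gaussian wave packets
(FBI/Gabor inversion with Gaussian window): for every Schwartz function `f`,
`2^{d/2} (2πε)^{−3d/2} ∬ G^ε_{q,p}(x) ⟨G^ε_{q,p}, f⟩ dq dp = f(x)`. -/
theorem gaussian_wave_packet_resolution_of_identity
    {d : ℕ} (hd : 1 ≤ d) (ε : ℝ) (hε : 0 < ε)
    (G : EuclideanSpace ℝ (Fin d) → EuclideanSpace ℝ (Fin d) →
      EuclideanSpace ℝ (Fin d) → ℂ)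
    (hG : ∀ q p x, G q p x
      = Complex.exp (((-‖x - q‖ ^ 2 / (2 * ε) : ℝ) : ℂ)
          + Complex.I * ((⟪p, x - q⟫_ℝ / ε : ℝ) : ℂ)))
    (f : SchwartzMap (EuclideanSpace ℝ (Fin d)) ℂ)
    (x : EuclideanSpace ℝ (Fin d)) :
    ((((2 : ℝ) ^ ((d : ℝ) / 2) * (2 * Real.pi * ε) ^ (-(3 * (d : ℝ)) / 2)) : ℝ) : ℂ)
        * ∫ p : EuclideanSpace ℝ (Fin d),
            ∫ q : EuclideanSpace ℝ (Fin d),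
              G q p x * ∫ y : EuclideanSpace ℝ (Fin d),
                (starRingEnd ℂ) (G q p y) * f y
      = f x := by
  have hπ := Real.pi_pos
  let h : EuclideanSpace ℝ (Fin d) → ℂ :=
    fun y ↦ ((Real.exp (-(1 / (4 * ε)) * ‖x - y‖ ^ 2) : ℝ) : ℂ) * f y
  let g : EuclideanSpace ℝ (Fin d) → EuclideanSpace ℝ (Fin d) → ℂ :=
    fun q y ↦
      ((Real.exp (-‖x - q‖ ^ 2 / (2 * ε)) * Real.exp (-‖y - q‖ ^ 2 / (2 * ε)) : ℝ) : ℂ)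
  let φ : EuclideanSpace ℝ (Fin d) → EuclideanSpace ℝ (Fin d) → ℂ :=
    fun p y ↦ Complex.exp (Complex.I * ((⟪p, x - y⟫_ℝ / ε : ℝ) : ℂ))
  have hprod (q p y : EuclideanSpace ℝ (Fin d)) : G q p x * ((starRingEnd ℂ) (G q p y) * f y)
      = g q y * (φ p y * f y) := by
    simp only [hG, g, φ, ← Complex.exp_conj, map_add, map_mul, Complex.conj_I, Complex.conj_ofReal,
      Complex.ofReal_mul, Complex.ofReal_exp, ← mul_assoc, ← Complex.exp_add]
    congr 2
    rw [inner_sub_right, inner_sub_right, inner_sub_right]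
    push_cast
    ring
  have hintegrable (p : EuclideanSpace ℝ (Fin d)) :
      Integrable (Function.uncurry fun q y ↦ g q y * (φ p y * f y)) (volume.prod volume) := by
    refine ((integrable_exp_neg_sq_norm_sub hε x).mul_prod f.integrable.norm).mono'
      (Continuous.aestronglyMeasurable (by fun_prop)) (.of_forall fun ⟨q, y⟩ ↦ ?_)
    have hφ : ‖φ p y‖ = 1 := by simp only [φ, mul_comm Complex.I, Complex.norm_exp_ofReal_mul_I]
    simp only [Function.uncurry_apply_pair, g, norm_mul, hφ, one_mul, Complex.norm_real,
      Real.norm_of_nonneg (Real.exp_pos _).le]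
    gcongr
    refine mul_le_of_le_one_right (Real.exp_pos _).le (Real.exp_le_one_iff.2 ?_)
    rw [neg_div, neg_nonpos]
    positivity
  have hq (p : EuclideanSpace ℝ (Fin d)) :
      ∫ q : EuclideanSpace ℝ (Fin d), G q p x * ∫ y : EuclideanSpace ℝ (Fin d), (starRingEnd ℂ) (G q p y) * f y
        = ((Real.pi * ε) ^ ((d : ℝ) / 2) : ℝ) * ∫ y : EuclideanSpace ℝ (Fin d), φ p y * h y := by
    simp_rw [← integral_const_mul, hprod]
    rw [integral_integral_swap (hintegrable p)]
    refine integral_congr_ae (.of_forall fun y ↦ ?_)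
    simp only [g]
    rw [integral_mul_const, integral_complex_ofReal, integral_exp_neg_sq_norm_sub_mul hε,
      finrank_euclideanSpace_fin]
    simp only [h]
    push_cast
    ring
  have ha : 0 < 1 / (4 * ε) := by positivity
  simp_rw [hq]
  rw [integral_const_mul, integral_integral_cexp_inner_sub_mul hε (h := h) (by fun_prop)
    (integrable_gaussian_mul_schwartz ha x f) (integrable_fourier_gaussian_mul_schwartz ha x f),
    finrank_euclideanSpace_fin]
  have hx : h x = f x := by simp [h]
  have hconst : (2 : ℝ) ^ ((d : ℝ) / 2) * (2 * Real.pi * ε) ^ (-(3 * (d : ℝ)) / 2)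
      * ((Real.pi * ε) ^ ((d : ℝ) / 2) * (2 * Real.pi * ε) ^ d) = 1 := by
    rw [mul_mul_mul_comm, ← Real.mul_rpow (by norm_num) (by positivity), ← mul_assoc 2,
      ← Real.rpow_natCast, ← Real.rpow_add (by positivity), ← Real.rpow_add (by positivity)]
    convert Real.rpow_zero _ using 2
    ring
  rw [hx, ← mul_assoc, ← mul_assoc, mul_assoc ((_ : ℝ) : ℂ), ← Complex.ofReal_mul,
    ← Complex.ofReal_mul, hconst, Complex.ofReal_one, one_mul]
end
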